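/- There is no finite group of order 4800 (= 64·75 = 2⁶·3·5²) that has an irreducible complex character of degree 64. -/

import Mathlib

open CategoryTheory

/-- `χ : G → ℂ` is the character of an irreducible (simple) finite-dimensional complex
representation of the group `G`. -/
def IsIrrChar (G : Type) [Group G] (χ : G → ℂ) : Prop :=
  ∃ V : FDRep ℂ G, Simple V ∧ FDRep.character V = χ

namespace Representation

section Weight

variable {A V : Type*} [CommGroup A] [AddCommGroup V] [Module ℂ V]

/-- The twist of a representation by the inverse of a linear character. -/
def twistInv (ρ : Representation ℂ A V) (l : A →* ℂˣ) : Representation ℂ A V where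
  toFun a := ((l a)⁻¹ : ℂˣ) • ρ a
  map_one' := by simp
  map_mul' a b := by
    rw [map_mul, map_mul, mul_inv, smul_mul_smul_comm]

/-- The simultaneous eigenspace of an abelian group with eigenvalues given by a linear character. -/
noncomputable def weightSpace (ρ : Representation ℂ A V) (l : A →* ℂˣ) : Submodule ℂ V :=
  (ρ.twistInv l).invariants

theorem mem_weightSpace {ρ : Representation ℂ A V} {l : A →* ℂˣ} {v : V} :
    v ∈ ρ.weightSpace l ↔ ∀ a, ρ a v = (l a : ℂˣ) • v := by
  simp only [weightSpace, mem_invariants]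
  refine forall_congr' fun a ↦ ?_
  change (l a)⁻¹ • ρ a v = v ↔ _
  rw [inv_smul_eq_iff]

theorem card_mul_finrank_weightSpace [Fintype A] [FiniteDimensional ℂ V]
    (ρ : Representation ℂ A V) (l : A →* ℂˣ) :
    (Nat.card A : ℂ) * Module.finrank ℂ (ρ.weightSpace l) =
      ∑ a, ((l a)⁻¹ : ℂˣ) * ρ.character a := by
  have h0 : (Nat.card A : ℂ) ≠ 0 := by simp
  let : Invertible (Nat.card A : ℂ) := invertibleOfNonzero h0
  have h := (ρ.twistInv l).card_inv_mul_sum_char_eq_finrank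
  rw [weightSpace, ← h, mul_inv_cancel_left₀ h0]
  refine Finset.sum_congr rfl fun a _ ↦ ?_
  change LinearMap.trace ℂ V (((l a)⁻¹ : ℂˣ) • ρ a) = _
  rw [Units.smul_def, map_smul]
  rfl

theorem sum_monoidHom_apply [Finite A] [Fintype (A →* ℂˣ)] [DecidableEq A] (a : A) :
    ∑ l : A →* ℂˣ, ((l a : ℂˣ) : ℂ) = if a = 1 then (Nat.card A : ℂ) else 0 := by
  split_ifs with h
  · subst h
    simp [← CommGroup.card_monoidHom_of_hasEnoughRootsOfUnity A ℂ]
  · obtain ⟨φ, hφ⟩ := CommGroup.exists_apply_ne_one_of_hasEnoughRootsOfUnity A ℂ h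
    have : ((φ a : ℂˣ) : ℂ) * ∑ l : A →* ℂˣ, ((l a : ℂˣ) : ℂ) = ∑ l : A →* ℂˣ, ((l a : ℂˣ) : ℂ) := by
      rw [Finset.mul_sum]
      exact Fintype.sum_equiv (Equiv.mulLeft φ) _ _ fun l ↦ by simp
    have h1 : (((φ a : ℂˣ) : ℂ) - 1) * ∑ l : A →* ℂˣ, ((l a : ℂˣ) : ℂ) = 0 := by
      rw [sub_mul, this, one_mul, sub_self]
    refine (mul_eq_zero.mp h1).resolve_left fun h2 ↦ hφ ?_
    exact Units.ext (by simpa [sub_eq_zero] using h2)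

theorem character_eq_sum_weight [Finite A] [Fintype (A →* ℂˣ)] [FiniteDimensional ℂ V]
    (ρ : Representation ℂ A V) (b : A) :
    ρ.character b = ∑ l : A →* ℂˣ, (Module.finrank ℂ (ρ.weightSpace l) : ℂ) * (l b : ℂˣ) := by
  classical
  let := Fintype.ofFinite A
  have h0 : (Nat.card A : ℂ) ≠ 0 := by simp
  refine mul_left_cancel₀ h0 ?_
  calc (Nat.card A : ℂ) * ρ.character b
      = ∑ a, ρ.character a * if a⁻¹ * b = 1 then (Nat.card A : ℂ) else 0 := by
        simp only [inv_mul_eq_one, mul_ite, mul_zero, Finset.sum_ite_eq', Finset.mem_univ, if_true]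
        ring
    _ = ∑ a, ∑ l : A →* ℂˣ, ρ.character a * ((l (a⁻¹ * b) : ℂˣ) : ℂ) := by
        simp_rw [← sum_monoidHom_apply, Finset.mul_sum]
    _ = ∑ l : A →* ℂˣ, ∑ a, ρ.character a * ((l (a⁻¹ * b) : ℂˣ) : ℂ) := Finset.sum_comm
    _ = _ := by
        rw [Finset.mul_sum]
        refine Finset.sum_congr rfl fun l _ ↦ ?_
        rw [← mul_assoc, card_mul_finrank_weightSpace, Finset.sum_mul]
        refine Finset.sum_congr rfl fun a _ ↦ ?_
        simp only [map_mul, map_inv, Units.val_mul]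
        ring

theorem sum_character_mul_character_inv [Fintype A] [Fintype (A →* ℂˣ)] [FiniteDimensional ℂ V]
    (ρ : Representation ℂ A V) :
    ∑ a, ρ.character a * ρ.character a⁻¹ =
      (Nat.card A * ∑ l : A →* ℂˣ, Module.finrank ℂ (ρ.weightSpace l) ^ 2 : ℕ) := by
  simp_rw [ρ.character_eq_sum_weight (_⁻¹), Finset.mul_sum]
  rw [Finset.sum_comm, Nat.cast_sum]
  refine Finset.sum_congr rfl fun l _ ↦ ?_
  rw [Nat.cast_mul, Nat.cast_pow, pow_two, ← mul_assoc, card_mul_finrank_weightSpace, Finset.sum_mul]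
  refine Finset.sum_congr rfl fun a _ ↦ ?_
  simp only [map_inv]
  ring

theorem eq_of_mem_weightSpace {ρ : Representation ℂ A V} {l m : A →* ℂˣ} {v : V}
    (hl : v ∈ ρ.weightSpace l) (hm : v ∈ ρ.weightSpace m) (hv : v ≠ 0) : l = m := by
  ext a
  have h := (mem_weightSpace.mp hl a).symm.trans (mem_weightSpace.mp hm a)
  simp only [Units.smul_def] at h
  exact smul_left_injective ℂ hv h

theorem character_inv_eq_conj_of_comm [Finite A] [FiniteDimensional ℂ V]
    (ρ : Representation ℂ A V) (x : A) :
    ρ.character x⁻¹ = (starRingEnd ℂ) (ρ.character x) := by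
  have : Finite (A →* ℂˣ) := Nat.finite_of_card_ne_zero (by
    rw [CommGroup.card_monoidHom_of_hasEnoughRootsOfUnity]; exact Nat.card_pos.ne')
  let := Fintype.ofFinite (A →* ℂˣ)
  rw [character_eq_sum_weight, character_eq_sum_weight, map_sum]
  refine Finset.sum_congr rfl fun l _ ↦ ?_
  have hn : ‖((l x : ℂˣ) : ℂ)‖ = 1 := by
    refine Complex.norm_eq_one_of_pow_eq_one (n := Nat.card A) ?_ Nat.card_pos.ne'
    rw [← Units.val_pow_eq_pow_val, ← map_pow, pow_card_eq_one', map_one, Units.val_one]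
  rw [map_mul, Complex.conj_natCast, map_inv, Units.val_inv_eq_inv_val, Complex.inv_eq_conj hn]

end Weight

section Group

variable {G V : Type*} [Group G] [Finite G] [AddCommGroup V] [Module ℂ V] [FiniteDimensional ℂ V]

theorem character_inv_eq_conj (ρ : Representation ℂ G V) (g : G) :
    ρ.character g⁻¹ = (starRingEnd ℂ) (ρ.character g) := by
  let A := Subgroup.zpowers g
  let : CommGroup A := { (inferInstance : Group A) with mul_comm := mul_comm' }
  exact character_inv_eq_conj_of_comm (ρ.comp A.subtype) ⟨g, Subgroup.mem_zpowers g⟩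

end Group

section Clifford

variable {G A V : Type*} [Group G] [CommGroup A] [AddCommGroup V] [Module ℂ V]

/-- The unnormalised projection of a representation onto a weight space of an abelian group. -/
noncomputable def weightProj [Fintype A] (σ : Representation ℂ A V) (l : A →* ℂˣ) :
    V →ₗ[ℂ] V :=
  ∑ a, (((l a)⁻¹ : ℂˣ) : ℂ) • σ a

theorem weightProj_apply [Fintype A] (σ : Representation ℂ A V) (l : A →* ℂˣ) (v : V) :
    σ.weightProj l v = ∑ a, (((l a)⁻¹ : ℂˣ) : ℂ) • σ a v := by
  simp [weightProj]

theorem weightProj_mem [Fintype A] (σ : Representation ℂ A V) (l : A →* ℂˣ) (v : V) :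
    σ.weightProj l v ∈ σ.weightSpace l := by
  rw [mem_weightSpace]
  intro b
  rw [weightProj_apply, map_sum, Units.smul_def, Finset.smul_sum]
  refine Fintype.sum_equiv (Equiv.mulLeft b) _ _ fun a ↦ ?_
  rw [Equiv.coe_mulLeft, map_smul, smul_smul, map_mul, mul_inv, Units.val_mul, ← mul_assoc,
    Units.mul_inv, one_mul, map_mul, Module.End.mul_apply]

theorem exists_weightProj_eq_smul [Fintype A] {σ : Representation ℂ A V} {m : A →* ℂˣ} {v : V}
    (hv : v ∈ σ.weightSpace m) (l : A →* ℂˣ) : ∃ z : ℂ, σ.weightProj l v = z • v := by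
  refine ⟨∑ a, (((l a)⁻¹ : ℂˣ) : ℂ) * (m a : ℂˣ), ?_⟩
  rw [weightProj_apply, Finset.sum_smul]
  refine Finset.sum_congr rfl fun a _ ↦ ?_
  rw [mem_weightSpace.mp hv a, Units.smul_def, smul_smul]

theorem trace_weightProj [Fintype A] [FiniteDimensional ℂ V] (σ : Representation ℂ A V)
    (l : A →* ℂˣ) :
    LinearMap.trace ℂ V (σ.weightProj l) = Nat.card A * Module.finrank ℂ (σ.weightSpace l) := by
  rw [card_mul_finrank_weightSpace, weightProj, map_sum]
  refine Finset.sum_congr rfl fun a _ ↦ ?_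
  rw [map_smul]
  rfl

/-- Conjugation by `g⁻¹` sends a vector of weight `m` to a vector of weight `m` twisted by `g`. -/
theorem apply_inv_mem_weightSpace {ρ : Representation ℂ G V} {ι : A →* G} {c : G → A →* A}
    (hc : ∀ g a, ι (c g a) = g * ι a * g⁻¹) {m : A →* ℂˣ} {v : V}
    (hv : v ∈ weightSpace (ρ.comp ι) m) (g : G) :
    ρ g⁻¹ v ∈ weightSpace (ρ.comp ι) (m.comp (c g)) := by
  rw [mem_weightSpace] at hv ⊢
  intro a
  have h := hv (c g a)
  rw [MonoidHom.comp_apply, hc] at h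
  rw [MonoidHom.comp_apply, MonoidHom.comp_apply, Units.smul_def, ← map_smul, ← Units.smul_def,
    ← h, ← Module.End.mul_apply, ← Module.End.mul_apply, ← map_mul, ← map_mul]
  congr 2
  group

/-- The weights of a normal abelian subgroup on an irreducible representation are conjugate. -/
theorem exists_comp_eq_of_weightSpace_ne_bot [Finite G] [Finite A] [FiniteDimensional ℂ V]
    {ρ : Representation ℂ G V} {ι : A →* G} {c : G → A →* A}
    (hc : ∀ g a, ι (c g a) = g * ι a * g⁻¹)
    (hρ : ∀ T : V →ₗ[ℂ] V, (∀ g, T * ρ g = ρ g * T) → ∃ z : ℂ, T = z • 1)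
    {l m : A →* ℂˣ} (hl : weightSpace (ρ.comp ι) l ≠ ⊥) (hm : weightSpace (ρ.comp ι) m ≠ ⊥) :
    ∃ g, m.comp (c g) = l := by
  let := Fintype.ofFinite A
  let := Fintype.ofFinite G
  let e : V →ₗ[ℂ] V := weightProj (ρ.comp ι) l
  let T : V →ₗ[ℂ] V := ∑ g, ρ g * e * ρ g⁻¹
  obtain ⟨z, hz⟩ := hρ T fun h ↦ by
    rw [Finset.sum_mul, Finset.mul_sum]
    refine Fintype.sum_equiv (Equiv.mulLeft h⁻¹) _ _ fun g ↦ ?_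
    rw [Equiv.coe_mulLeft, mul_assoc, mul_assoc, ← map_mul, ← mul_assoc (ρ h), ← mul_assoc (ρ h),
      ← map_mul, mul_inv_rev, inv_inv, mul_inv_cancel_left, mul_assoc]
  have htr : LinearMap.trace ℂ V T =
      Nat.card G * (Nat.card A * Module.finrank ℂ (weightSpace (ρ.comp ι) l)) := by
    rw [map_sum, ← trace_weightProj, Finset.sum_congr rfl fun g _ ↦ (?_ :
      LinearMap.trace ℂ V (ρ g * e * ρ g⁻¹) = LinearMap.trace ℂ V e)]
    · simp [e]
    · rw [LinearMap.trace_mul_comm, ← mul_assoc, ← map_mul, inv_mul_cancel, map_one, one_mul]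
  have hT : T ≠ 0 := by
    intro h0
    rw [h0, map_zero] at htr
    have : Module.finrank ℂ (weightSpace (ρ.comp ι) l) ≠ 0 := by
      rwa [Ne, Submodule.finrank_eq_zero]
    have h1 : (Nat.card G : ℂ) ≠ 0 := by simp
    have h2 : (Nat.card A : ℂ) ≠ 0 := by simp
    exact mul_ne_zero h1 (mul_ne_zero h2 (Nat.cast_ne_zero.mpr this)) htr.symm
  obtain ⟨v, hv, hv0⟩ := Submodule.exists_mem_ne_zero_of_ne_bot hm
  have hTv : T v ≠ 0 := by
    have hz0 : z ≠ 0 := by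
      rintro rfl
      exact hT (by rw [hz, zero_smul])
    rw [hz]
    exact smul_ne_zero hz0 hv0
  obtain ⟨g, hg⟩ : ∃ g, e (ρ g⁻¹ v) ≠ 0 := by
    by_contra! h
    refine hTv ?_
    simp [T, LinearMap.sum_apply, Module.End.mul_apply, h]
  have hw := apply_inv_mem_weightSpace hc hv g
  obtain ⟨w, hwe⟩ := exists_weightProj_eq_smul hw l
  refine ⟨g, eq_of_mem_weightSpace (v := e (ρ g⁻¹ v)) ?_ (weightProj_mem _ _ _) hg⟩
  change weightProj (ρ.comp ι) l (ρ g⁻¹ v) ∈ _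
  rw [hwe]
  exact Submodule.smul_mem _ _ hw

theorem finrank_weightSpace_le [Finite G] [Finite A] [FiniteDimensional ℂ V]
    {ρ : Representation ℂ G V} {ι : A →* G} {c : G → A →* A}
    (hc : ∀ g a, ι (c g a) = g * ι a * g⁻¹)
    (hρ : ∀ T : V →ₗ[ℂ] V, (∀ g, T * ρ g = ρ g * T) → ∃ z : ℂ, T = z • 1)
    {l m : A →* ℂˣ} (hl : weightSpace (ρ.comp ι) l ≠ ⊥) (hm : weightSpace (ρ.comp ι) m ≠ ⊥) :
    Module.finrank ℂ (weightSpace (ρ.comp ι) m) ≤ Module.finrank ℂ (weightSpace (ρ.comp ι) l) := by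
  obtain ⟨g, rfl⟩ := exists_comp_eq_of_weightSpace_ne_bot hc hρ hl hm
  refine LinearMap.finrank_le_finrank_of_injective
    (f := (ρ g⁻¹).restrict fun v hv ↦ apply_inv_mem_weightSpace hc hv g) fun v w h ↦ ?_
  have h1 : ρ g⁻¹ v = ρ g⁻¹ w := congrArg Subtype.val h
  have h2 := congrArg (ρ g) h1
  rw [← Module.End.mul_apply, ← Module.End.mul_apply, ← map_mul, mul_inv_cancel, map_one] at h2
  exact Subtype.ext h2

/-- A normal abelian subgroup acts on an irreducible representation through `t` weights of common
multiplicity `e`; either `t = 1` or the trivial weight does not occur. -/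
theorem exists_weight_count [Fintype G] [Finite A] [FiniteDimensional ℂ V]
    {ρ : Representation ℂ G V} {ι : A →* G} (hι : Function.Injective ι) {c : G → A →* A}
    (hc : ∀ g a, ι (c g a) = g * ι a * g⁻¹)
    (hρ : ∀ T : V →ₗ[ℂ] V, (∀ g, T * ρ g = ρ g * T) → ∃ z : ℂ, T = z • 1)
    (hn : ∑ g, ρ.character g * ρ.character g⁻¹ = Nat.card G) (hV : 0 < Module.finrank ℂ V) :
    ∃ t e : ℕ, t * e = Module.finrank ℂ V ∧ Nat.card A * (Module.finrank ℂ V * e) ≤ Nat.card G ∧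
      (t = 1 ∨ t < Nat.card A) := by
  classical
  have hfin : Finite (A →* ℂˣ) := Nat.finite_of_card_ne_zero (by
    rw [CommGroup.card_monoidHom_of_hasEnoughRootsOfUnity]; exact Nat.card_pos.ne')
  let := Fintype.ofFinite (A →* ℂˣ)
  let := Fintype.ofFinite A
  let d : (A →* ℂˣ) → ℕ := fun l ↦ Module.finrank ℂ (weightSpace (ρ.comp ι) l)
  have hd : ∑ l, d l = Module.finrank ℂ V := by
    have := character_eq_sum_weight (ρ.comp ι) 1
    rw [char_one] at this
    simp only [map_one, Units.val_one, mul_one] at this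
    exact_mod_cast this.symm
  have hd0 (l) : d l ≠ 0 ↔ weightSpace (ρ.comp ι) l ≠ ⊥ := not_congr Submodule.finrank_eq_zero
  have heq {l m} (hl : d l ≠ 0) (hm : d m ≠ 0) : d l = d m :=
    le_antisymm (finrank_weightSpace_le hc hρ ((hd0 m).mp hm) ((hd0 l).mp hl))
      (finrank_weightSpace_le hc hρ ((hd0 l).mp hl) ((hd0 m).mp hm))
  obtain ⟨l₀, -, hl₀⟩ : ∃ l ∈ Finset.univ, d l ≠ 0 := by
    by_contra! h
    rw [Finset.sum_eq_zero h] at hd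
    exact hV.ne hd
  let S : Finset (A →* ℂˣ) := Finset.univ.filter fun l ↦ d l ≠ 0
  have hS : S.card * d l₀ = Module.finrank ℂ V := by
    rw [← hd, ← smul_eq_mul, ← Finset.sum_const, Finset.sum_filter]
    refine Finset.sum_congr rfl fun l _ ↦ ?_
    split_ifs with h
    · exact heq hl₀ h
    · exact (not_not.mp h).symm
  refine ⟨S.card, d l₀, hS, ?_, ?_⟩
  · have h1 := sum_character_mul_character_inv (ρ.comp ι)
    have h2 : ∑ l, d l ^ 2 = Module.finrank ℂ V * d l₀ := by
      rw [← hd, Finset.sum_mul]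
      refine Finset.sum_congr rfl fun l _ ↦ ?_
      by_cases h : d l = 0
      · simp [h]
      · rw [pow_two, heq h hl₀]
    have hchar (g : G) : ρ.character g * ρ.character g⁻¹ = (‖ρ.character g‖ ^ 2 : ℝ) := by
      rw [character_inv_eq_conj, Complex.mul_conj, Complex.normSq_eq_norm_sq]
    have h3 : ∑ g, ‖ρ.character g‖ ^ 2 = (Nat.card G : ℝ) := by
      simp_rw [hchar] at hn
      exact_mod_cast hn
    have h4 : ∑ a, ‖ρ.character (ι a)‖ ^ 2 = (Nat.card A * ∑ l, d l ^ 2 : ℕ) := by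
      have : ∑ a, ρ.character (ι a) * ρ.character (ι a)⁻¹ = (Nat.card A * ∑ l, d l ^ 2 : ℕ) := by
        simp_rw [← map_inv]
        exact h1
      simp_rw [hchar] at this
      exact_mod_cast this
    have h5 : ∑ a, ‖ρ.character (ι a)‖ ^ 2 ≤ ∑ g, ‖ρ.character g‖ ^ 2 := by
      rw [← Finset.sum_image (s := Finset.univ) (g := ι) (f := fun g ↦ ‖ρ.character g‖ ^ 2)
        hι.injOn]
      exact Finset.sum_le_sum_of_subset_of_nonneg (Finset.subset_univ _) fun _ _ _ ↦ by positivity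
    rw [h4, h3, h2] at h5
    exact_mod_cast h5
  · by_cases h : d 1 = 0
    · right
      rw [← CommGroup.card_monoidHom_of_hasEnoughRootsOfUnity A ℂ, Nat.card_eq_fintype_card]
      refine Finset.card_lt_univ_of_notMem (x := 1) ?_
      simp [S, h]
    · left
      refine Finset.card_eq_one.mpr ⟨1, Finset.eq_singleton_iff_unique_mem.mpr ⟨by simp [S, h], ?_⟩⟩
      intro l hl
      obtain ⟨g, hg⟩ := exists_comp_eq_of_weightSpace_ne_bot hc hρ
        ((hd0 l).mp (Finset.mem_filter.mp hl).2) ((hd0 1).mp h)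
      rw [← hg]
      rfl

end Clifford

end Representation

theorem FDRep.exists_eq_smul_one_of_simple {G : Type} [Group G] [Finite G] (V : FDRep ℂ G)
    [Simple V] {T : V →ₗ[ℂ] V} (hT : ∀ g, T * V.ρ g = V.ρ g * T) : ∃ z : ℂ, T = z • 1 := by
  have h1 : Module.finrank ℂ (Representation.linHom V.ρ V.ρ).invariants = 1 := by
    rw [LinearEquiv.finrank_eq (Representation.linHom.invariantsEquivFDRepHom V V)]
    exact finrank_endomorphism_simple_eq_one ℂ V
  have hmem {S : V →ₗ[ℂ] V} (hS : ∀ g, S * V.ρ g = V.ρ g * S) :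
      S ∈ (Representation.linHom V.ρ V.ρ).invariants := fun g ↦ by
    change V.ρ g * (S * V.ρ g⁻¹) = S
    rw [hS, ← mul_assoc, ← map_mul, mul_inv_cancel, map_one, one_mul]
  obtain ⟨⟨U, hU⟩, hU0, hspan⟩ := finrank_eq_one_iff'.mp h1
  obtain ⟨a, ha⟩ := hspan ⟨T, hmem hT⟩
  obtain ⟨b, hb⟩ := hspan ⟨1, hmem fun g ↦ by rw [one_mul, mul_one]⟩
  have ha' : a • U = T := congrArg Subtype.val ha
  have hb' : b • U = 1 := congrArg Subtype.val hb
  by_cases hb0 : b = 0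
  · rw [hb0, zero_smul] at hb'
    refine ⟨0, LinearMap.ext fun v ↦ ?_⟩
    have hv : v = 0 := (LinearMap.congr_fun hb' v).symm
    simp [hv]
  · exact ⟨a * b⁻¹, by rw [← hb', smul_smul, inv_mul_cancel_right₀ hb0, ha']⟩

theorem Subgroup.eq_bot_of_isMulCommutative_of_isIrreducible {G : Type} [Group G] [Finite G]
    (hcard : Nat.card G = 4800) (V : FDRep ℂ G) [Simple V] (hV : Module.finrank ℂ V = 64)
    (N : Subgroup G) [N.Normal] [IsMulCommutative N] {p : ℕ} (hp : p.Prime) (hN : IsPGroup p N) :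
    N = ⊥ := by
  let := Fintype.ofFinite G
  let : CommGroup N := { (inferInstance : Group N) with mul_comm := mul_comm' }
  have : Fact p.Prime := ⟨hp⟩
  obtain ⟨t, e, hte, hA, ht⟩ := Representation.exists_weight_count (ρ := V.ρ) (A := N)
    (ι := N.subtype) N.subtype_injective (c := fun g ↦ (MulAut.conjNormal g : N ≃* N).toMonoidHom)
    (fun g a ↦ MulAut.conjNormal_apply g a) (fun T hT ↦ FDRep.exists_eq_smul_one_of_simple V hT)
    ((FDRep.simple_iff_char_is_norm_one V).mp inferInstance) (by rw [hV]; norm_num)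
  rw [hV] at hte hA
  rw [hcard] at hA
  have hdvd : Nat.card N ∣ 4800 := hcard ▸ N.card_subgroup_dvd_card
  obtain ⟨k, hk⟩ := IsPGroup.iff_card.mp hN
  have h75 : Nat.card N ≠ 75 := by
    intro h
    rw [hk] at h
    have h3 : 3 ∣ p ^ k := by rw [h]; norm_num
    have h5 : 5 ∣ p ^ k := by rw [h]; norm_num
    have := (Nat.prime_dvd_prime_iff_eq Nat.prime_three hp).mp (Nat.prime_three.dvd_of_dvd_pow h3)
    have := (Nat.prime_dvd_prime_iff_eq Nat.prime_five hp).mp (Nat.prime_five.dvd_of_dvd_pow h5)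
    omega
  have hpos : 0 < Nat.card N := Nat.card_pos
  rw [← Subgroup.card_eq_one]
  generalize Nat.card N = n at *
  have he : e ∣ 64 := ⟨t, by rw [mul_comm]; exact hte.symm⟩
  have he' : e ∈ Nat.divisors 64 := by simp [he]
  rw [show Nat.divisors 64 = {1, 2, 4, 8, 16, 32, 64} by rfl] at he'
  simp only [Finset.mem_insert, Finset.mem_singleton] at he'
  have hn : n ≤ 75 := by
    rcases he' with rfl | rfl | rfl | rfl | rfl | rfl | rfl <;> omega
  rcases he' with rfl | rfl | rfl | rfl | rfl | rfl | rfl <;> interval_cases n <;> omega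

section Sylow

variable {G : Type*} [Group G] [Finite G]

/-- A simple group embeds in the symmetric group on the cosets of a proper subgroup. -/
theorem IsSimpleGroup.card_dvd_factorial_index [IsSimpleGroup G] {K : Subgroup G} (hK : K ≠ ⊤) :
    Nat.card G ∣ K.index.factorial := by
  have hbot : K.normalCore = ⊥ := by
    refine (IsSimpleGroup.eq_bot_or_eq_top_of_normal _ K.normalCore_normal).resolve_right ?_
    intro h
    exact hK (top_le_iff.mp (h ▸ K.normalCore_le))
  rw [Subgroup.normalCore_eq_ker, MonoidHom.ker_eq_bot_iff] at hbot
  have h := Subgroup.card_dvd_of_injective _ hbot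
  rwa [Nat.card_perm, ← Subgroup.index] at h

theorem IsSimpleGroup.prime_card_of_squarefree [IsSimpleGroup G] (h : Squarefree (Nat.card G)) :
    (Nat.card G).Prime := by
  have := IsZGroup.of_squarefree h
  let : CommGroup G :=
    { (inferInstance : Group G) with mul_comm := IsSimpleGroup.comm_iff_isSolvable.mpr inferInstance }
  exact IsSimpleGroup.prime_card

theorem IsPGroup.of_squarefree_of_isSimpleGroup [IsSimpleGroup G] (h : Squarefree (Nat.card G)) :
    ∃ p, p.Prime ∧ IsPGroup p G :=
  ⟨_, IsSimpleGroup.prime_card_of_squarefree h, IsPGroup.of_card (pow_one _).symm⟩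

omit [Finite G] in
theorem IsPGroup.of_sylow_eq_top {p : ℕ} {P : Sylow p G} (h : (P : Subgroup G) = ⊤) :
    IsPGroup p G := fun g ↦ by
  obtain ⟨k, hk⟩ := P.2 ⟨g, by rw [h]; trivial⟩
  exact ⟨k, congrArg Subtype.val hk⟩

theorem Sylow.card_ne_one_of_isSimpleGroup [IsSimpleGroup G] {p : ℕ} [Fact p.Prime]
    (hp : p ∣ Nat.card G) (hG : ¬ IsPGroup p G) : Nat.card (Sylow p G) ≠ 1 := by
  intro h
  have := (Nat.card_eq_one_iff_unique.mp h).1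
  let P : Sylow p G := default
  have hn := P.normal_of_subsingleton
  rcases IsSimpleGroup.eq_bot_or_eq_top_of_normal _ hn with h | h
  · have := P.not_dvd_index
    rw [h, Subgroup.index_bot] at this
    exact this hp
  · exact hG (IsPGroup.of_sylow_eq_top h)

omit [Finite G] in
theorem Sylow.eq_of_le {p : ℕ} {P Q : Sylow p G} (h : (P : Subgroup G) ≤ Q) : P = Q :=
  (Sylow.ext (P.3 Q.2 h)).symm

omit [Finite G] in
theorem Sylow.card_orbit_eq_relIndex {p : ℕ} [Fact p.Prime] (P R : Sylow p G) :
    Nat.card (MulAction.orbit (P : Subgroup G) R) =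
      (R : Subgroup G).relIndex P := by
  rw [Nat.card_coe_set_eq, ← MulAction.index_stabilizer, Subgroup.relIndex]
  congr 1
  ext x
  rw [MulAction.mem_stabilizer_iff, Subgroup.mem_subgroupOf]
  change (x : G) • R = R ↔ _
  rw [Sylow.smul_eq_iff_mem_normalizer]
  have h := P.2.inf_normalizer_sylow R
  constructor
  · intro hx
    have : (x : G) ∈ (P : Subgroup G) ⊓ Subgroup.normalizer (R : Set G) := ⟨x.2, hx⟩
    rw [h] at this
    exact this.2
  · exact fun hx ↦ Subgroup.le_normalizer hx

/-- If the number of Sylow `p`-subgroups is not `1` modulo `p ^ (i + 1)`, then any one of them meets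
another one in a subgroup of index at most `p ^ i`. -/
theorem Sylow.exists_ne_relIndex_dvd {p : ℕ} [Fact p.Prime] {i : ℕ}
    (h : ¬ Nat.card (Sylow p G) ≡ 1 [MOD p ^ (i + 1)]) (P : Sylow p G) :
    ∃ R : Sylow p G, R ≠ P ∧ (R : Subgroup G).relIndex P ∣ p ^ i := by
  classical
  by_contra! hR
  refine h ?_
  have hdvd (R : Sylow p G) (hne : R ≠ P) : p ^ (i + 1) ∣ (R : Subgroup G).relIndex P := by
    obtain ⟨n, hn⟩ := IsPGroup.iff_card.mp P.2
    have h1 : (R : Subgroup G).relIndex P ∣ p ^ n :=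
      hn ▸ Subgroup.index_dvd_card ((R : Subgroup G).subgroupOf P)
    obtain ⟨m, -, hm⟩ := (Nat.dvd_prime_pow Fact.out).mp h1
    have h2 := hR R hne
    rw [hm] at h2 ⊢
    refine pow_dvd_pow _ ?_
    by_contra! hlt
    exact h2 (pow_dvd_pow _ (Nat.lt_succ_iff.mp hlt))
  let Ω := MulAction.orbitRel.Quotient (P : Subgroup G) (Sylow p G)
  let := Fintype.ofFinite Ω
  have hcard : Nat.card (Sylow p G) =
      ∑ ω : Ω, (ω.out : Subgroup G).relIndex P := by
    rw [Nat.card_congr (MulAction.selfEquivSigmaOrbits (P : Subgroup G) (Sylow p G)), Nat.card_sigma]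
    exact Finset.sum_congr rfl fun ω _ ↦ Sylow.card_orbit_eq_relIndex P _
  let ω₀ : Ω := Quotient.mk _ P
  have h0 : ω₀.out = P := by
    have h1 : ω₀.out ∈ MulAction.orbit (P : Subgroup G) P := by
      rw [← MulAction.orbitRel_apply]
      exact Quotient.mk_out (s := MulAction.orbitRel _ _) P
    obtain ⟨x, hx⟩ := h1
    rw [← hx]
    change (x : G) • P = P
    rw [Sylow.smul_eq_iff_mem_normalizer]
    exact Subgroup.le_normalizer x.2
  rw [hcard, ← Finset.add_sum_erase _ _ (Finset.mem_univ ω₀), h0, Subgroup.relIndex_self]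
  have : p ^ (i + 1) ∣ ∑ ω ∈ Finset.univ.erase ω₀, (ω.out : Subgroup G).relIndex P := by
    refine Finset.dvd_sum fun ω hω ↦ hdvd _ fun he ↦ (Finset.mem_erase.mp hω).1 ?_
    rw [← Quotient.out_eq ω, he]
  exact ((Nat.modEq_zero_iff_dvd.mpr this).add_left 1)

omit [Finite G] in
theorem Sylow.relIndex_ne_one {p : ℕ} {P R : Sylow p G} (h : R ≠ P) :
    (R : Subgroup G).relIndex P ≠ 1 := fun h1 ↦
  h (Sylow.eq_of_le (Subgroup.relIndex_eq_one.mp h1)).symm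

omit [Finite G] in
theorem Subgroup.le_normalizer_inf_of_relIndex_eq_two {P R : Subgroup G} (h : R.relIndex P = 2) :
    P ≤ normalizer (R ⊓ P : Subgroup G) := by
  rw [← Subgroup.normal_subgroupOf_iff_le_normalizer inf_le_right]
  exact Subgroup.normal_of_index_eq_two (by
    rw [← Subgroup.relIndex, Subgroup.inf_relIndex_right, h])

omit [Finite G] in
theorem Subgroup.card_inf_mul_relIndex (P R : Subgroup G) :
    Nat.card (R ⊓ P : Subgroup G) * R.relIndex P = Nat.card P := by
  have h := Subgroup.relIndex_mul_relIndex ⊥ (R ⊓ P) P bot_le inf_le_right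
  rwa [Subgroup.relIndex_bot_left, Subgroup.relIndex_bot_left, Subgroup.inf_relIndex_right] at h

theorem Sylow.relIndex_comm {p : ℕ} [Fact p.Prime] (P R : Sylow p G) :
    (R : Subgroup G).relIndex P = (P : Subgroup G).relIndex R := by
  have h1 := Subgroup.card_inf_mul_relIndex (P : Subgroup G) R
  have h2 := Subgroup.card_inf_mul_relIndex (R : Subgroup G) P
  rw [← Nat.card_congr (P.equiv R).toEquiv, ← h1, inf_comm] at h2
  exact (Nat.eq_of_mul_eq_mul_left Nat.card_pos h2).symm

theorem Nat.dvd_of_not_dvd_of_dvd_mul_prime {p n m : ℕ} (hp : p.Prime) (hn : ¬ p ∣ n) {k : ℕ}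
    (h : n ∣ p ^ k * m) : n ∣ m :=
  Nat.Coprime.dvd_of_dvd_mul_left
    (Nat.Coprime.pow_right k ((Nat.Prime.coprime_iff_not_dvd hp).mpr hn).symm) h

theorem squarefree_thirty : Squarefree 30 := by
  rw [Nat.squarefree_iff_nodup_primeFactorsList (by norm_num)]
  simp

theorem IsSimpleGroup.exists_isPGroup_or_of_index_five [IsSimpleGroup G]
    {K : Subgroup G} (hK : K.index = 5) :
    (∃ p, p.Prime ∧ IsPGroup p G) ∨ Nat.card (Sylow 5 G) = 6 := by
  have : Fact (Nat.Prime 5) := ⟨Nat.prime_five⟩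
  have hne : K ≠ ⊤ := by
    rintro rfl
    simp at hK
  have h1 := IsSimpleGroup.card_dvd_factorial_index hne
  rw [hK] at h1
  have h5 : 5 ∣ Nat.card G := hK ▸ K.index_dvd_card
  by_cases hp : IsPGroup 5 G
  · exact Or.inl ⟨5, Nat.prime_five, hp⟩
  have hn1 := Sylow.card_ne_one_of_isSimpleGroup h5 hp
  right
  let Q : Sylow 5 G := default
  have h24 : Nat.card (Sylow 5 G) ∣ 24 := by
    refine Q.card_dvd_index.trans (Nat.dvd_of_not_dvd_of_dvd_mul_prime Nat.prime_five
      Q.not_dvd_index (k := 1) ?_)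
    exact (Subgroup.index_dvd_card _).trans h1
  have hmod : Nat.card (Sylow 5 G) % 5 = 1 := card_sylow_modEq_one 5 G
  generalize Nat.card (Sylow 5 G) = n at *
  have : n ≤ 24 := Nat.le_of_dvd (by norm_num) h24
  interval_cases n <;> omega

theorem IsSimpleGroup.exists_isPGroup_or_of_index_three [IsSimpleGroup G]
    {K : Subgroup G} (hK : K.index = 3) : ∃ p, p.Prime ∧ IsPGroup p G := by
  have hne : K ≠ ⊤ := by
    rintro rfl
    simp at hK
  have h1 := IsSimpleGroup.card_dvd_factorial_index hne
  rw [hK] at h1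
  exact IsPGroup.of_squarefree_of_isSimpleGroup
    (squarefree_thirty.squarefree_of_dvd (h1.trans (by decide)))

theorem IsSimpleGroup.exists_isPGroup_or_of_card_dvd_960 [IsSimpleGroup G]
    (hG : Nat.card G ∣ 960) :
    (∃ p, p.Prime ∧ IsPGroup p G) ∨ Nat.card (Sylow 5 G) = 6 := by
  have : Fact (Nat.Prime 2) := ⟨Nat.prime_two⟩
  let P : Sylow 2 G := default
  have hP : (P : Subgroup G).index ∣ 15 :=
    Nat.dvd_of_not_dvd_of_dvd_mul_prime Nat.prime_two P.not_dvd_index (k := 6)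
      ((Subgroup.index_dvd_card _).trans hG)
  have hcard := Subgroup.card_mul_index (P : Subgroup G)
  have key {K : Subgroup G} (hPK : (P : Subgroup G) ≤ K) (hK : K ≠ ⊤) (hK' : K.index ≠ 15) :
      (∃ p, p.Prime ∧ IsPGroup p G) ∨ Nat.card (Sylow 5 G) = 6 := by
    have h1 : K.index ∣ 15 := (Subgroup.index_dvd_of_le hPK).trans hP
    have h2 : K.index ≠ 1 := by rwa [Ne, Subgroup.index_eq_one]
    have h3 : K.index = 3 ∨ K.index = 5 := by
      have : K.index ≤ 15 := Nat.le_of_dvd (by norm_num) h1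
      generalize K.index = n at *
      interval_cases n <;> omega
    rcases h3 with h3 | h3
    · exact Or.inl (IsSimpleGroup.exists_isPGroup_or_of_index_three h3)
    · exact IsSimpleGroup.exists_isPGroup_or_of_index_five h3
  have hn := P.card_eq_index_normalizer
  by_cases hpt : (P : Subgroup G) = ⊤
  · exact Or.inl ⟨2, Nat.prime_two, IsPGroup.of_sylow_eq_top hpt⟩
  by_cases hpb : (P : Subgroup G) = ⊥
  · left
    rw [hpb, Subgroup.index_bot] at hP
    exact IsPGroup.of_squarefree_of_isSimpleGroup
      (squarefree_thirty.squarefree_of_dvd (hP.trans (by decide)))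
  by_cases h15 : Nat.card (Sylow 2 G) = 15
  · obtain ⟨R, hRP, hR⟩ := P.exists_ne_relIndex_dvd (i := 1) (by rw [h15]; decide)
    have h2 : (R : Subgroup G).relIndex P = 2 :=
      ((Nat.dvd_prime Nat.prime_two).mp (by simpa using hR)).resolve_left (Sylow.relIndex_ne_one hRP)
    have h2' : (P : Subgroup G).relIndex R = 2 := by rw [← Sylow.relIndex_comm, h2]
    have hN1 := Subgroup.le_normalizer_inf_of_relIndex_eq_two h2
    have hN2 := Subgroup.le_normalizer_inf_of_relIndex_eq_two h2'
    rw [inf_comm] at hN2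
    by_cases hD : (R ⊓ P : Subgroup G) = ⊥
    · left
      have := Subgroup.card_inf_mul_relIndex (P : Subgroup G) R
      rw [hD, h2, Subgroup.card_bot, one_mul] at this
      rw [← this] at hcard
      refine IsPGroup.of_squarefree_of_isSimpleGroup (squarefree_thirty.squarefree_of_dvd ?_)
      rw [← hcard]
      exact mul_dvd_mul_left 2 hP
    · refine key hN1 (fun h ↦ ?_) (fun h ↦ ?_)
      · rcases IsSimpleGroup.eq_bot_or_eq_top_of_normal _ (Subgroup.normalizer_eq_top_iff.mp h)
          with h | h
        · exact hD h
        · exact hpt (top_le_iff.mp (h ▸ inf_le_right))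
      · have h3 := Subgroup.relIndex_mul_index hN1
        have h4 : (P : Subgroup G).index ≤ 15 := Nat.le_of_dvd (by norm_num) hP
        have h5 : (P : Subgroup G).index ≠ 0 := Subgroup.index_ne_zero_of_finite
        rw [h] at h3
        have h6 : (P : Subgroup G).relIndex (Subgroup.normalizer (R ⊓ P : Subgroup G)) = 1 := by
          omega
        exact hRP (Sylow.eq_of_le (hN2.trans (Subgroup.relIndex_eq_one.mp h6)))
  · refine key Subgroup.le_normalizer (fun h ↦ ?_) (hn ▸ h15)
    rcases IsSimpleGroup.eq_bot_or_eq_top_of_normal _ (Subgroup.normalizer_eq_top_iff.mp h)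
      with h | h
    · exact hpb h
    · exact hpt h

end Sylow

section OrderOneHundredFifty

variable {G : Type*} [Group G] [Finite G]

omit [Finite G] in
theorem Subgroup.le_centralizer_of_isMulCommutative {H K : Subgroup G} [IsMulCommutative K]
    (h : H ≤ K) : K ≤ centralizer (H : Set G) :=
  K.le_centralizer.trans (centralizer_le h)

omit [Finite G] in
/-- A `p`-group acting on a normal subgroup of order prime to and not `1` modulo `p` fixes a
nontrivial element. -/
theorem IsPGroup.exists_ne_one_mem_centralizer {p : ℕ} [Fact p.Prime] {Q : Subgroup G}
    (hQ : IsPGroup p Q) (T : Subgroup G) [Finite T] [T.Normal]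
    (hT : ¬ Nat.card T ≡ 1 [MOD p]) :
    ∃ x ∈ T, x ≠ 1 ∧ x ∈ Subgroup.centralizer (Q : Set G) := by
  let : MulAction Q T := MulAction.compHom T ((MulAut.conjNormal (H := T)).comp Q.subtype)
  have hsmul (q : Q) (x : T) : ((q • x : T) : G) = q * x * (q : G)⁻¹ :=
    MulAut.conjNormal_apply (q : G) x
  have h := hQ.card_modEq_card_fixedPoints T
  by_contra! hx
  refine hT (h.trans ?_)
  have : Nat.card (MulAction.fixedPoints Q T) = 1 := by
    refine Nat.card_eq_one_iff_unique.mpr ⟨⟨fun x y ↦ ?_⟩, ⟨1, fun q ↦ Subtype.ext ?_⟩⟩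
    · have key (z : MulAction.fixedPoints Q T) : ((z : T) : G) = 1 := by
        by_contra hz
        refine hx _ z.1.2 hz (Subgroup.mem_centralizer_iff.mpr fun q hq ↦ ?_)
        have h2 := congrArg Subtype.val (z.2 ⟨q, hq⟩)
        rw [hsmul] at h2
        exact mul_inv_eq_iff_eq_mul.mp h2
      exact Subtype.ext (Subtype.ext ((key x).trans (key y).symm))
    · rw [hsmul]
      simp
  rw [this]

theorem Sylow.card_five_ne_six_of_card_eq (hG : Nat.card G = 150) :
    Nat.card (Sylow 5 G) ≠ 6 := by
  intro h6
  have : Fact (Nat.Prime 5) := ⟨Nat.prime_five⟩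
  have : Fact (Nat.Prime 3) := ⟨Nat.prime_three⟩
  let Q : Sylow 5 G := default
  have hcard := Subgroup.card_mul_index (Q : Subgroup G)
  obtain ⟨k, hk⟩ := IsPGroup.iff_card.mp Q.2
  have hQ : Nat.card (Q : Subgroup G) = 25 := by
    have h1 := Q.not_dvd_index
    rw [hG, hk] at hcard
    rw [hk]
    have hk4 : k < 4 := by
      by_contra! hlt
      have : 5 ^ 4 ∣ 150 := (pow_dvd_pow 5 hlt).trans (Dvd.intro _ hcard)
      omega
    interval_cases k <;> omega
  have hN : Subgroup.normalizer (Q : Set G) = Q := by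
    have h1 := Q.card_eq_index_normalizer
    have h2 := Subgroup.card_mul_index (Subgroup.normalizer (Q : Set G))
    rw [← h1, h6, hG] at h2
    refine (Subgroup.eq_of_le_of_card_ge Subgroup.le_normalizer ?_).symm
    rw [hQ]
    change Nat.card (Subgroup.normalizer (Q : Set G)) ≤ 25
    omega
  have : IsMulCommutative Q := IsPGroup.isMulCommutative_of_card_eq_prime_sq (p := 5) hQ
  have hNC : Subgroup.normalizer (Q : Set G) ≤ Subgroup.centralizer (Q : Set G) := by
    rw [hN]
    exact (Q : Subgroup G).le_centralizer
  have hM := MonoidHom.ker_transferSylow_isComplement' Q hNC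
  let M := (MonoidHom.transferSylow Q hNC).ker
  have hMcard : Nat.card M = 6 := by
    have : Nat.card M * Nat.card (Q : Subgroup G) = _ := hM.card_mul_card
    rw [hQ] at this
    omega
  let T : Sylow 3 M := default
  have hT : Nat.card (T : Subgroup M) = 3 := by
    have h1 := Subgroup.card_mul_index (T : Subgroup M)
    have h2 := T.not_dvd_index
    obtain ⟨j, hj⟩ := IsPGroup.iff_card.mp T.2
    rw [hj, hMcard] at h1
    rw [hj]
    have hj4 : j < 2 := by
      by_contra! hlt
      have : 3 ^ 2 ∣ 6 := (pow_dvd_pow 3 hlt).trans (Dvd.intro _ h1)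
      omega
    interval_cases j <;> omega
  have hTn : Nat.card (Sylow 3 M) = 1 := by
    have h1 := T.card_dvd_index
    have h2 := Subgroup.card_mul_index (T : Subgroup M)
    rw [hMcard] at h2
    have h3 : (T : Subgroup M).index = 2 := by
      rw [hT] at h2
      omega
    rw [h3] at h1
    have h4 : Nat.card (Sylow 3 M) % 3 = 1 := card_sylow_modEq_one 3 M
    have h5 := Nat.le_of_dvd (by norm_num) h1
    omega
  have := (Nat.card_eq_one_iff_unique.mp hTn).1
  let T' : Subgroup G := (T : Subgroup M).map M.subtype
  have hT' : Nat.card T' = 3 := by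
    rw [← hT]
    exact Subgroup.card_map_of_injective M.subtype_injective
  obtain ⟨x, hxT, hx1, hxQ⟩ := Q.2.exists_ne_one_mem_centralizer T' (by rw [hT']; decide)
  have h1 : x ∈ (Q : Subgroup G) := hN ▸ Subgroup.centralizer_le_normalizer _ hxQ
  have h2 : x ∈ M := Subgroup.map_subtype_le _ hxT
  exact hx1 (Subgroup.disjoint_def.mp hM.disjoint h2 h1)

end OrderOneHundredFifty

section FiveSquared

open scoped Pointwise

variable {G : Type*} [Group G] [Finite G]

omit [Finite G] in
theorem Subgroup.inv_mul_mem_normalizer_of_conj_smul_eq {D : Subgroup G} {g h : G}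
    (e : MulAut.conj g • D = MulAut.conj h • D) : g⁻¹ * h ∈ normalizer (D : Set G) := by
  rw [Subgroup.mem_normalizer_iff]
  intro x
  have h1 : h * x * h⁻¹ ∈ MulAut.conj h • D ↔ x ∈ D := by
    rw [Subgroup.mem_pointwise_smul_iff_inv_smul_mem, ← map_inv, MulAut.smul_def,
      MulAut.conj_apply]
    group
  rw [← h1, ← e, Subgroup.mem_pointwise_smul_iff_inv_smul_mem, ← map_inv, MulAut.smul_def,
    MulAut.conj_apply]
  group

theorem IsSimpleGroup.eq_one_of_commute_normalizer [IsSimpleGroup G] {p : ℕ} [Fact p.Prime]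
    (hG : ¬ IsPGroup p G) (Q : Sylow p G) [IsMulCommutative Q] {c : G} (hc : c ∈ Q)
    (hN : ∀ n ∈ Subgroup.normalizer (Q : Set G), n * c = c * n) : c = 1 := by
  let : CommGroup Q := { (inferInstance : Group Q) with mul_comm := mul_comm' }
  let τ : G →* Q := MonoidHom.transfer (MonoidHom.id Q)
  have key (k : ℕ) (g : G) (hg : g⁻¹ * c ^ k * g ∈ (Q : Subgroup G)) :
      g⁻¹ * c ^ k * g = c ^ k := by
    obtain ⟨n, hn, h⟩ := Q.conj_eq_normalizer_conj_of_mem (c ^ k) g (pow_mem hc k) hg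
    rw [h, mul_assoc, inv_mul_eq_iff_eq_mul]
    exact (Commute.pow_right (hN n hn) k).symm
  have hτ : τ c = ⟨c ^ (Q : Subgroup G).index, _⟩ := MonoidHom.transfer_eq_pow _ c key
  have h1 : c ^ (Q : Subgroup G).index = 1 := by
    rcases IsSimpleGroup.eq_bot_or_eq_top_of_normal τ.ker inferInstance with h | h
    · exact absurd (Q.2.of_injective τ ((MonoidHom.ker_eq_bot_iff τ).mp h)) hG
    · have h2 : τ c = 1 := by
        rw [← MonoidHom.mem_ker, h]
        trivial
      rw [hτ] at h2
      exact congrArg Subtype.val h2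
  obtain ⟨k, hk⟩ := Q.2 ⟨c, hc⟩
  have hk' : c ^ p ^ k = 1 := congrArg Subtype.val hk
  have hco : Nat.Coprime (Q : Subgroup G).index (p ^ k) :=
    Nat.Coprime.pow_right _ ((Nat.Prime.coprime_iff_not_dvd Fact.out).mpr Q.not_dvd_index).symm
  rw [← orderOf_eq_one_iff]
  exact Nat.eq_one_of_dvd_coprimes hco (orderOf_dvd_of_pow_eq_one h1) (orderOf_dvd_of_pow_eq_one hk')

/-- If an abelian Sylow subgroup has index two in its normalizer, then the remaining elements of
the normalizer invert it. -/
theorem IsSimpleGroup.conj_eq_inv_of_relIndex_eq_two [IsSimpleGroup G] {p : ℕ} [Fact p.Prime]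
    (hG : ¬ IsPGroup p G) (Q : Sylow p G) [IsMulCommutative Q]
    (hQ : (Q : Subgroup G).relIndex (Subgroup.normalizer (Q : Set G)) = 2) {t q : G}
    (ht : t ∈ Subgroup.normalizer (Q : Set G)) (htQ : t ∉ Q) (hq : q ∈ Q) :
    t * q * t⁻¹ = q⁻¹ := by
  have hcomm {x y : G} (hx : x ∈ Q) (hy : y ∈ Q) : x * y = y * x :=
    congrArg Subtype.val (mul_comm' (⟨x, hx⟩ : Q) ⟨y, hy⟩)
  have hmul {x y : G} (hx : x ∈ Subgroup.normalizer (Q : Set G))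
      (hy : y ∈ Subgroup.normalizer (Q : Set G)) : x * y ∈ Q ↔ (x ∈ Q ↔ y ∈ Q) :=
    Subgroup.mul_mem_iff_of_index_two hQ (a := ⟨x, hx⟩) (b := ⟨y, hy⟩)
  have hconj {x : G} (hx : x ∈ Q) : t * x * t⁻¹ ∈ Q := (Subgroup.mem_normalizer_iff.mp ht x).mp hx
  have hqt := hconj hq
  rw [← mul_eq_one_iff_eq_inv]
  refine IsSimpleGroup.eq_one_of_commute_normalizer hG Q (mul_mem hqt hq) fun n hn ↦ ?_
  by_cases hnQ : n ∈ Q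
  · exact hcomm hnQ (mul_mem hqt hq)
  · have htn : t⁻¹ * n ∈ Q := (hmul (inv_mem ht) hn).mpr (by simp [htQ, hnQ])
    have htt : t * t ∈ Q := (hmul ht ht).mpr Iff.rfl
    have h1 : t * (t * q * t⁻¹) * t⁻¹ = q := by
      rw [show t * (t * q * t⁻¹) * t⁻¹ = (t * t) * q * (t * t)⁻¹ by group, hcomm htt hq,
        mul_inv_cancel_right]
    have h2 : t * (t * q * t⁻¹ * q) = (t * q * t⁻¹ * q) * t := by
      have : t * (t * q * t⁻¹ * q) * t⁻¹ = t * q * t⁻¹ * q := by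
        rw [show t * (t * q * t⁻¹ * q) * t⁻¹ = (t * (t * q * t⁻¹) * t⁻¹) * (t * q * t⁻¹) by group,
          h1, hcomm hq hqt]
      exact mul_inv_eq_iff_eq_mul.mp this
    rw [show n = t * (t⁻¹ * n) by group, mul_assoc, hcomm htn (mul_mem hqt hq), ← mul_assoc, h2,
      mul_assoc]

omit [Finite G] in
theorem Sylow.six_le_card_filter_le {P R : Sylow 5 G} [Fintype (Sylow 5 G)] [IsMulCommutative P]
    (hRP : R ≠ P) (h5 : (R : Subgroup G).relIndex P = 5)
    [DecidablePred fun A : Sylow 5 G ↦ (R ⊓ P : Subgroup G) ≤ A] :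
    6 ≤ (Finset.univ.filter fun A : Sylow 5 G ↦ (R ⊓ P : Subgroup G) ≤ A).card := by
  classical
  have : Fact (Nat.Prime 5) := ⟨Nat.prime_five⟩
  let O : Finset (Sylow 5 G) := (MulAction.orbit (P : Subgroup G) R).toFinset
  have hO : O.card = 5 := by
    refine Eq.trans ?_ h5
    rw [← Sylow.card_orbit_eq_relIndex, Nat.card_coe_set_eq, Set.ncard_eq_toFinset_card']
  have hPO : P ∉ O := by
    intro h
    obtain ⟨x, hx⟩ := Set.mem_toFinset.mp h
    refine hRP ?_
    change (x : G) • R = P at hx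
    rw [← eq_inv_smul_iff] at hx
    rw [hx, Sylow.smul_eq_iff_mem_normalizer]
    exact Subgroup.le_normalizer (inv_mem x.2)
  refine le_trans (b := (insert P O).card) (by rw [Finset.card_insert_of_notMem hPO, hO])
    (Finset.card_le_card fun A hA ↦ ?_)
  rw [Finset.mem_filter]
  refine ⟨Finset.mem_univ _, ?_⟩
  rcases Finset.mem_insert.mp hA with rfl | hA
  · exact inf_le_right
  obtain ⟨x, rfl⟩ := Set.mem_toFinset.mp hA
  change _ ≤ MulAut.conj (x : G) • (R : Subgroup G)
  intro d hd
  rw [Subgroup.mem_pointwise_smul_iff_inv_smul_mem, ← map_inv, MulAut.smul_def, MulAut.conj_apply]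
  have hc : (x : G)⁻¹ * d = d * (x : G)⁻¹ :=
    congrArg Subtype.val (mul_comm' (⟨(x : G)⁻¹, inv_mem x.2⟩ : P) ⟨d, hd.2⟩)
  rw [hc, inv_inv, inv_mul_cancel_right]
  exact hd.1

/-- Counting ordered pairs of distinct Sylow `5`-subgroups according to their intersection. -/
theorem Sylow.index_normalizer_mul_thirty_le {P R : Sylow 5 G} [IsMulCommutative P]
    (hRP : R ≠ P) (hP : Nat.card (P : Subgroup G) = 25)
    (h5 : (R : Subgroup G).relIndex P = 5) :
    (Subgroup.normalizer ((R ⊓ P : Subgroup G) : Set G)).index * 30 ≤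
      Nat.card (Sylow 5 G) * Nat.card (Sylow 5 G) - Nat.card (Sylow 5 G) := by
  classical
  have : Fact (Nat.Prime 5) := ⟨Nat.prime_five⟩
  let := Fintype.ofFinite (Sylow 5 G)
  let := Fintype.ofFinite G
  set D : Subgroup G := R ⊓ P with hD
  set L := Subgroup.normalizer (D : Set G)
  let := Fintype.ofFinite (G ⧸ L)
  set E := Finset.univ.filter fun A : Sylow 5 G ↦ D ≤ A with hE
  have hE6 : 6 ≤ E.card := Sylow.six_le_card_filter_le hRP h5
  have hE30 : 30 ≤ E.offDiag.card := by
    rw [Finset.offDiag_card, ← Nat.mul_sub_one]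
    have h1 : 5 ≤ E.card - 1 := by omega
    exact Nat.mul_le_mul hE6 h1
  have hDcard : Nat.card D = 5 := by
    have := Subgroup.card_inf_mul_relIndex (P : Subgroup G) R
    rw [hP, h5] at this
    change Nat.card (R ⊓ P : Subgroup G) = 5
    omega
  have hint {A B : Sylow 5 G} (hAB : (A, B) ∈ E.offDiag) : (A ⊓ B : Subgroup G) = D := by
    rw [Finset.mem_offDiag, Finset.mem_filter, Finset.mem_filter] at hAB
    obtain ⟨⟨-, hA⟩, ⟨-, hB⟩, hne⟩ := hAB
    refine (Subgroup.eq_of_le_of_card_ge (le_inf hA hB) ?_).symm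
    have h1 := Subgroup.card_inf_mul_relIndex (B : Subgroup G) A
    have h2 : (A : Subgroup G).relIndex B ≠ 1 := Sylow.relIndex_ne_one hne
    have h3 : Nat.card (B : Subgroup G) = 25 := by rw [← hP]; exact Nat.card_congr (B.equiv P).toEquiv
    rw [h3] at h1
    have h4 : Nat.card (A ⊓ B : Subgroup G) ∈ Nat.divisors (5 ^ 2) := by
      rw [Nat.mem_divisors]
      exact ⟨Dvd.intro _ h1, by norm_num⟩
    rw [Nat.divisors_prime_pow Nat.prime_five] at h4
    obtain ⟨i, hi, hi'⟩ := Finset.mem_map.mp h4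
    have hi3 : i < 3 := Finset.mem_range.mp hi
    change 5 ^ i = _ at hi'
    rw [hDcard, ← hi']
    rw [← hi'] at h1
    interval_cases i <;> omega
  have hle : ((Finset.univ : Finset (G ⧸ L)) ×ˢ E.offDiag).card ≤
      (Finset.univ : Finset (Sylow 5 G)).offDiag.card := by
    refine Finset.card_le_card_of_injOn
      (fun x ↦ (x.1.out • x.2.1, x.1.out • x.2.2)) (fun x hx ↦ ?_) ?_
    · have h := (Finset.mem_offDiag.mp (Finset.mem_product.mp hx).2).2.2
      rw [Finset.mem_coe, Finset.mem_offDiag]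
      exact ⟨Finset.mem_univ _, Finset.mem_univ _, fun e ↦ h (smul_left_cancel _ e)⟩
    · rintro ⟨q, A, B⟩ hx ⟨q', A', B'⟩ hx' e
      have hA : q.out • A = q'.out • A' := congrArg Prod.fst e
      have hB : q.out • B = q'.out • B' := congrArg Prod.snd e
      have h1 := hint (Finset.mem_product.mp hx).2
      have h2 := hint (Finset.mem_product.mp hx').2
      have hq : q = q' := by
        rw [← Quotient.out_eq' q, ← Quotient.out_eq' q']
        refine QuotientGroup.eq.mpr (Subgroup.inv_mul_mem_normalizer_of_conj_smul_eq ?_)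
        nth_rw 1 [← h1]
        rw [← h2, Subgroup.smul_inf, Subgroup.smul_inf, ← Sylow.coe_subgroup_smul,
          ← Sylow.coe_subgroup_smul, ← Sylow.coe_subgroup_smul, ← Sylow.coe_subgroup_smul, hA, hB]
      subst hq
      rw [smul_left_cancel _ hA, smul_left_cancel _ hB]
  rw [Finset.card_product, Finset.offDiag_card Finset.univ, Finset.card_univ, Finset.card_univ,
    ← Nat.card_eq_fintype_card, ← Nat.card_eq_fintype_card] at hle
  exact (Nat.mul_le_mul_left _ hE30).trans hle

theorem IsSimpleGroup.card_sylow_five_ne_ninetySix [IsSimpleGroup G]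
    (hcard : Nat.card G ∣ 4800) (hG : ¬ IsPGroup 5 G) {P R : Sylow 5 G} (hRP : R ≠ P)
    (hP : Nat.card (P : Subgroup G) = 25) (h5 : (R : Subgroup G).relIndex P = 5)
    (hL : 10 ≤ (Subgroup.normalizer ((R ⊓ P : Subgroup G) : Set G)).index) :
    Nat.card (Sylow 5 G) ≠ 96 := by
  intro h96
  have : Fact (Nat.Prime 5) := ⟨Nat.prime_five⟩
  have hR : Nat.card (R : Subgroup G) = 25 := by
    rw [← hP]
    exact Nat.card_congr (R.equiv P).toEquiv
  have hPc : IsMulCommutative P := IsPGroup.isMulCommutative_of_card_eq_prime_sq (p := 5) hP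
  have hRc : IsMulCommutative R := IsPGroup.isMulCommutative_of_card_eq_prime_sq (p := 5) hR
  set D : Subgroup G := R ⊓ P with hD
  have hDcard : Nat.card D = 5 := by
    have := Subgroup.card_inf_mul_relIndex (P : Subgroup G) R
    rw [hP, h5] at this
    change Nat.card (R ⊓ P : Subgroup G) = 5
    omega
  have hGpos : 0 < Nat.card G := Nat.card_pos
  have hGle : Nat.card G ≤ 4800 := Nat.le_of_dvd (by norm_num) hcard
  set N := Subgroup.normalizer (P : Set G) with hN
  have hPN : (P : Subgroup G) ≤ N := Subgroup.le_normalizer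
  have hNcard : Nat.card N * 96 = Nat.card G := by
    rw [← h96, P.card_eq_index_normalizer]
    exact Subgroup.card_mul_index _
  have hrel := Subgroup.card_mul_index ((P : Subgroup G).subgroupOf N)
  rw [Nat.card_congr (Subgroup.subgroupOfEquivOfLe hPN).toEquiv, hP,
    ← Subgroup.relIndex] at hrel
  have hrel2 : (P : Subgroup G).relIndex N = 2 := by
    have h1 : (P : Subgroup G).relIndex N ≠ 1 := by
      intro h1
      have hNP : N = P := le_antisymm (Subgroup.relIndex_eq_one.mp h1) hPN
      have hNC : N ≤ Subgroup.centralizer (P : Set G) := by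
        rw [hNP]
        exact (P : Subgroup G).le_centralizer
      have hM := MonoidHom.ker_transferSylow_isComplement' P hNC
      rcases IsSimpleGroup.eq_bot_or_eq_top_of_normal (MonoidHom.transferSylow P hNC).ker
        inferInstance with h | h
      · rw [h] at hM
        exact hG (IsPGroup.of_sylow_eq_top (Subgroup.isComplement'_bot_left.mp hM))
      · rw [h] at hM
        rw [Subgroup.isComplement'_top_left.mp hM, Subgroup.card_bot] at hP
        omega
    have h2 : 0 < Nat.card N := Nat.card_pos
    omega
  set L := Subgroup.normalizer (D : Set G) with hL'
  set C := Subgroup.centralizer (D : Set G) with hC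
  have hCL : C ≤ L := Subgroup.centralizer_le_normalizer _
  have hPC : (P : Subgroup G) ≤ C := Subgroup.le_centralizer_of_isMulCommutative inf_le_right
  have hRC : (R : Subgroup G) ≤ C := Subgroup.le_centralizer_of_isMulCommutative inf_le_left
  have hinv {t q : G} (ht : t ∈ N) (htP : t ∉ P) (hq : q ∈ P) : t * q * t⁻¹ = q⁻¹ :=
    IsSimpleGroup.conj_eq_inv_of_relIndex_eq_two hG P hrel2 ht htP hq
  have hNCP {t : G} (ht : t ∈ N) (htC : t ∈ C) : t ∈ P := by
    by_contra htP
    obtain ⟨d, hd, hd1⟩ := D.bot_or_exists_ne_one.resolve_left (by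
      rintro h
      rw [h, Subgroup.card_bot] at hDcard
      omega)
    have h1 := hinv ht htP hd.2
    rw [← Subgroup.mem_centralizer_iff.mp htC d hd, mul_inv_cancel_right] at h1
    have h2 : d ^ 2 = 1 := by
      rw [sq]
      nth_rewrite 1 [h1]
      exact inv_mul_cancel d
    have h5 : d ^ 5 = 1 := by
      have := pow_card_eq_one' (x := (⟨d, hd⟩ : D))
      rw [hDcard] at this
      exact congrArg Subtype.val this
    apply hd1
    calc d = d ^ 5 * (d ^ 2 * d ^ 2)⁻¹ := by group
      _ = 1 := by rw [h5, h2]; simp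
  obtain ⟨t, ht, htP⟩ : ∃ t ∈ N, t ∉ P := by
    by_contra! h
    have := Subgroup.relIndex_eq_one.mpr (show N ≤ P from h)
    omega
  have htL : t ∈ L := by
    have ht' : t⁻¹ ∈ N := inv_mem ht
    have htP' : t⁻¹ ∉ P := fun h => htP (inv_mem_iff.mp h)
    refine Subgroup.mem_normalizer_iff.mpr fun d => ⟨fun hd => ?_, fun hd => ?_⟩
    · rw [hinv ht htP hd.2]
      exact inv_mem hd
    · have h := hinv ht' htP' hd.2
      have h' : d = (t * d * t⁻¹)⁻¹ := by
        rw [← h]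
        group
      rw [h']
      exact inv_mem hd
  have hCcard : Nat.card C ≤ 240 := by
    have h1 : C.relIndex L ≠ 1 := fun h =>
      htP (hNCP ht (Subgroup.relIndex_eq_one.mp h htL))
    have h2 := Subgroup.card_mul_index (C.subgroupOf L)
    rw [Nat.card_congr (Subgroup.subgroupOfEquivOfLe hCL).toEquiv, ← Subgroup.relIndex] at h2
    have h3 := Subgroup.card_mul_index L
    have h4 : C.relIndex L ≠ 0 := by
      intro h
      rw [h] at h2
      have : 0 < Nat.card L := Nat.card_pos
      omega
    have h5 : 2 ≤ C.relIndex L := by omega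
    nlinarith [Nat.mul_le_mul_left (Nat.card C) h5, Nat.mul_le_mul_left (Nat.card L) hL]
  let P' : Sylow 5 C := P.subtype hPC
  let R' : Sylow 5 C := R.subtype hRC
  have hP' : Nat.card (P' : Subgroup C) = 25 := by
    rw [← hP]
    exact Nat.card_congr (Subgroup.subgroupOfEquivOfLe hPC).toEquiv
  have hnorm : Subgroup.normalizer (P' : Set C) = P' := by
    refine le_antisymm (fun t ht => ?_) Subgroup.le_normalizer
    refine Subgroup.mem_subgroupOf.mpr (hNCP ?_ t.2)
    refine Subgroup.mem_normalizer_iff.mpr fun x => ?_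
    have key {x : G} (hx : x ∈ C) : x ∈ (P : Subgroup G) ↔ (t : G) * x * (t : G)⁻¹ ∈ P :=
      Subgroup.mem_normalizer_iff.mp ht ⟨x, hx⟩
    refine ⟨fun hx => (key (hPC hx)).mp hx, fun hx => ?_⟩
    have hxC : x ∈ C := by
      have := C.mul_mem (C.mul_mem (C.inv_mem t.2) (hPC hx)) t.2
      simpa [mul_assoc] using this
    exact (key hxC).mpr hx
  have hn := Subgroup.card_mul_index (P' : Subgroup C)
  rw [hP', ← hnorm, ← P'.card_eq_index_normalizer] at hn
  have hmod : Nat.card (Sylow 5 C) % 5 = 1 := card_sylow_modEq_one 5 C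
  rcases (show Nat.card (Sylow 5 C) = 1 ∨ Nat.card (Sylow 5 C) = 6 by omega) with h | h
  · have hsub := (Nat.card_eq_one_iff_unique.mp h).1
    exact hRP (Sylow.subtype_injective (hP := hRC) (hQ := hPC) (hsub.elim R' P'))
  · exact Sylow.card_five_ne_six_of_card_eq (by omega) h

end FiveSquared

section Divisors

variable {G : Type*} [Group G] [Finite G]

theorem IsSimpleGroup.exists_isPGroup_or_of_card_dvd_4800 [IsSimpleGroup G]
    (hG : Nat.card G ∣ 4800) :
    (∃ p, p.Prime ∧ IsPGroup p G) ∨ Nat.card (Sylow 5 G) = 6 := by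
  have : Fact (Nat.Prime 5) := ⟨Nat.prime_five⟩
  by_cases h25 : 25 ∣ Nat.card G
  swap
  · refine IsSimpleGroup.exists_isPGroup_or_of_card_dvd_960 ?_
    obtain ⟨k, hk⟩ := hG
    have h5 : 5 ∣ k := by
      by_contra h5
      have hc : Nat.Coprime 25 k := by
        rw [show 25 = 5 ^ 2 by norm_num]
        exact ((Nat.prime_five.coprime_iff_not_dvd).mpr h5).pow_left 2
      exact h25 (hc.dvd_of_dvd_mul_right (hk ▸ by norm_num))
    obtain ⟨l, rfl⟩ := h5
    exact ⟨l, by linarith⟩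
  by_cases hp : IsPGroup 5 G
  · exact Or.inl ⟨5, Nat.prime_five, hp⟩
  right
  obtain ⟨P⟩ := (inferInstance : Nonempty (Sylow 5 G))
  have h5 : 5 ∣ Nat.card G := (by norm_num : 5 ∣ 25).trans h25
  have hmod : Nat.card (Sylow 5 G) % 5 = 1 := card_sylow_modEq_one 5 G
  have hone := Sylow.card_ne_one_of_isSimpleGroup h5 hp
  have hidx : ¬ 5 ∣ (P : Subgroup G).index := P.not_dvd_index
  have hPi := Subgroup.card_mul_index (P : Subgroup G)
  have hidx192 : (P : Subgroup G).index ∣ 192 :=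
    Nat.dvd_of_not_dvd_of_dvd_mul_prime (k := 2) (m := 192) Nat.prime_five hidx
      ((Subgroup.index_dvd_card _).trans hG)
  have hn192 : Nat.card (Sylow 5 G) ∣ 192 := P.card_dvd_index.trans hidx192
  have hPcard : Nat.card (P : Subgroup G) = 25 := by
    have h1 : 25 ∣ Nat.card (P : Subgroup G) := by
      have hc : Nat.Coprime 25 (P : Subgroup G).index := by
        rw [show 25 = 5 ^ 2 by norm_num]
        exact ((Nat.prime_five.coprime_iff_not_dvd).mpr hidx).pow_left 2
      exact hc.dvd_of_dvd_mul_right (hPi ▸ h25)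
    have h2 : Nat.card (P : Subgroup G) ∣ 25 := by
      have hc : Nat.Coprime (Nat.card (P : Subgroup G)) 192 := by
        obtain ⟨n, hn⟩ := IsPGroup.iff_card.mp P.isPGroup'
        rw [hn]
        exact Nat.Coprime.pow_left n (by norm_num)
      exact hc.dvd_of_dvd_mul_right ((Subgroup.card_subgroup_dvd_card _).trans hG)
    exact Nat.dvd_antisymm h2 h1
  have hPc : IsMulCommutative P := IsPGroup.isMulCommutative_of_card_eq_prime_sq (p := 5) hPcard
  have hcases : Nat.card (Sylow 5 G) = 6 ∨ Nat.card (Sylow 5 G) = 16 ∨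
      Nat.card (Sylow 5 G) = 96 := by
    have hle := Nat.le_of_dvd (by norm_num) hn192
    generalize Nat.card (Sylow 5 G) = n at *
    interval_cases n <;> simp_all
  by_contra h6
  obtain ⟨R, hRP, hRdvd⟩ := Sylow.exists_ne_relIndex_dvd (i := 1) (fun h => by
    have h : Nat.card (Sylow 5 G) % 25 = 1 := h
    omega) P
  have hrel : (R : Subgroup G).relIndex P = 5 :=
    ((Nat.dvd_prime Nat.prime_five).mp (by simpa using hRdvd)).resolve_left
      (Sylow.relIndex_ne_one hRP)
  have hDcard : Nat.card (R ⊓ P : Subgroup G) = 5 := by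
    have := Subgroup.card_inf_mul_relIndex (P : Subgroup G) R
    rw [hPcard, hrel] at this
    omega
  have hLtop : Subgroup.normalizer ((R ⊓ P : Subgroup G) : Set G) ≠ ⊤ := by
    rw [Ne, Subgroup.normalizer_eq_top_iff]
    intro hn
    rcases IsSimpleGroup.eq_bot_or_eq_top_of_normal _ hn with h | h
    · rw [h, Subgroup.card_bot] at hDcard
      omega
    · exact hp (IsPGroup.of_sylow_eq_top (P := P) (top_le_iff.mp (h ▸ inf_le_right)))
  have hL : 10 ≤ (Subgroup.normalizer ((R ⊓ P : Subgroup G) : Set G)).index := by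
    have h := h25.trans (IsSimpleGroup.card_dvd_factorial_index hLtop)
    by_contra! hlt
    generalize (Subgroup.normalizer ((R ⊓ P : Subgroup G) : Set G)).index = m at *
    interval_cases m <;> revert h <;> decide
  rcases hcases with h | h | h
  · exact h6 h
  · have := Sylow.index_normalizer_mul_thirty_le hRP hPcard hrel
    rw [h] at this
    omega
  · exact IsSimpleGroup.card_sylow_five_ne_ninetySix hG hp hRP hPcard hrel hL h

end Divisors

section NormalSubgroups

open scoped Pointwise

variable {G : Type*} [Group G]

/-- A normal `p`-subgroup of a normal subgroup is contained in a normal `p`-subgroup. -/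
theorem IsPGroup.exists_normal_of_normal [Finite G] {p : ℕ} {M : Subgroup G} [M.Normal]
    {N : Subgroup M} [hN : N.Normal] (hp : IsPGroup p N) (hbot : N ≠ ⊥) :
    ∃ N' : Subgroup G, N'.Normal ∧ N' ≠ ⊥ ∧ IsPGroup p N' := by
  let s : Set (Subgroup M) := {H | H.Normal ∧ IsPGroup p H}
  have hs : IsPGroup p (sSup s : Subgroup M) :=
    Sylow.sSup_of_normal s (fun H hH => hH.2) (fun H hH => hH.1)
  have hchar : (sSup s).Characteristic := by
    rw [Subgroup.characteristic_iff_map_le]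
    intro φ
    rw [sSup_eq_iSup, Subgroup.map_iSup]
    refine iSup_le fun H => ?_
    rw [Subgroup.map_iSup]
    refine iSup_le fun hH => ?_
    rw [← sSup_eq_iSup]
    exact le_sSup ⟨hH.1.map _ φ.surjective, hH.2.map _⟩
  refine ⟨(sSup s).map M.subtype, inferInstance, ?_, hs.map _⟩
  rw [Ne, Subgroup.map_eq_bot_iff_of_injective _ M.subtype_injective]
  exact fun h => hbot (le_bot_iff.mp (h ▸ le_sSup ⟨hN, hp⟩))

/-- A normal `p`-subgroup contains a normal abelian `p`-subgroup. -/
theorem IsPGroup.exists_normal_isMulCommutative [Finite G] {p : ℕ} [Fact p.Prime]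
    {N : Subgroup G} [N.Normal] (hp : IsPGroup p N) (hbot : N ≠ ⊥) :
    ∃ Z : Subgroup G, Z.Normal ∧ IsMulCommutative Z ∧ Z ≠ ⊥ ∧ IsPGroup p Z := by
  have : Nontrivial N := (Subgroup.nontrivial_iff_ne_bot N).mpr hbot
  have := hp.center_nontrivial
  refine ⟨(Subgroup.center N).map N.subtype, inferInstance, inferInstance, ?_,
    (hp.to_subgroup _).map _⟩
  rw [Ne, Subgroup.map_eq_bot_iff_of_injective _ N.subtype_injective]
  exact (Subgroup.nontrivial_iff_ne_bot _).mp this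

theorem Subgroup.card_mul_card_dvd_of_disjoint {H K : Subgroup G} [H.Normal]
    (h : Disjoint H K) : Nat.card H * Nat.card K ∣ Nat.card G := by
  rw [← H.card_mul_index]
  refine mul_dvd_mul_left _ ?_
  have h1 := H.relIndex_dvd_index_of_normal K
  rwa [← Subgroup.inf_relIndex_right, disjoint_iff.mp h, Subgroup.relIndex_bot_left] at h1

theorem Subgroup.disjoint_or_le_of_isSimpleGroup {H K : Subgroup G} [H.Normal]
    [IsSimpleGroup K] : Disjoint H K ∨ K ≤ H := by
  rcases IsSimpleGroup.eq_bot_or_eq_top_of_normal (H.subgroupOf K) inferInstance with h | h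
  · exact Or.inl (Subgroup.subgroupOf_eq_bot.mp h)
  · exact Or.inr (Subgroup.subgroupOf_eq_top.mp h)

/-- A simple normal subgroup `K` of a normal subgroup is normal, if `|K| ^ 2` does not divide
the order of the group. -/
theorem Subgroup.normal_map_subtype_of_isSimpleGroup [Finite G] {M : Subgroup G} [M.Normal]
    {K : Subgroup M} [hK : K.Normal] [IsSimpleGroup K]
    (h : ¬ Nat.card K * Nat.card K ∣ Nat.card M) : (K.map M.subtype).Normal := by
  refine ⟨?_⟩
  rintro _ ⟨x, hx, rfl⟩ g
  let φ : M ≃* M := MulAut.conjNormal g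
  have hn : (K.map φ.toMonoidHom).Normal := hK.map _ φ.surjective
  have hc : Nat.card (K.map φ.toMonoidHom) = Nat.card K :=
    Subgroup.card_map_of_injective φ.injective
  have hle : K ≤ K.map φ.toMonoidHom := by
    refine Subgroup.disjoint_or_le_of_isSimpleGroup.resolve_left fun hd => h ?_
    have := Subgroup.card_mul_card_dvd_of_disjoint hd
    rwa [hc] at this
  have heq := Subgroup.eq_of_le_of_card_ge hle hc.le
  refine ⟨φ x, ?_, MulAut.conjNormal_apply g x⟩
  rw [heq]
  exact Subgroup.mem_map_of_mem _ hx

theorem Sylow.thirty_dvd_card_of_card_eq_six [Finite G] (h : Nat.card (Sylow 5 G) = 6) :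
    30 ∣ Nat.card G := by
  have : Fact (Nat.Prime 5) := ⟨Nat.prime_five⟩
  obtain ⟨P⟩ := (inferInstance : Nonempty (Sylow 5 G))
  have h6 : 6 ∣ Nat.card G := by
    rw [← h]
    exact P.card_dvd_index.trans (Subgroup.index_dvd_card _)
  have h5 : 5 ∣ Nat.card G := by
    by_contra h5
    have hn : Nat.card (P : Subgroup G) = 1 := by
      obtain ⟨n, hn⟩ := IsPGroup.iff_card.mp P.isPGroup'
      rcases n with _ | n
      · simpa using hn
      · exact absurd (((dvd_pow_self 5 n.succ_ne_zero).trans hn.symm.dvd).trans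
          (Subgroup.card_subgroup_dvd_card _)) h5
    have hnormal : (P : Subgroup G).Normal := by
      rw [Subgroup.card_eq_one.mp hn]
      infer_instance
    have := Sylow.unique_of_normal P hnormal
    rw [Nat.card_unique] at h
    omega
  exact (by norm_num : Nat.Coprime 6 5).mul_dvd_of_dvd_of_dvd h6 h5

/-- A nontrivial group of order dividing `4800` has a nontrivial normal subgroup that is a `p`-group
or simple. -/
theorem exists_normal_isPGroup_or_isSimpleGroup [Finite G] [Nontrivial G]
    (hG : Nat.card G ∣ 4800) :
    (∃ p, p.Prime ∧ ∃ N : Subgroup G, N.Normal ∧ N ≠ ⊥ ∧ IsPGroup p N) ∨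
      ∃ K : Subgroup G, K.Normal ∧ IsSimpleGroup K := by
  induction hn : Nat.card G using Nat.strong_induction_on generalizing G with
  | _ n ih =>
    by_cases hs : IsSimpleGroup G
    · exact Or.inr ⟨⊤, inferInstance, Subgroup.topEquiv.isSimpleGroup⟩
    obtain ⟨M, hM, hMbot, hMtop⟩ : ∃ M : Subgroup G, M.Normal ∧ M ≠ ⊥ ∧ M ≠ ⊤ := by
      by_contra! h
      exact hs ⟨fun M hM => or_iff_not_imp_left.mpr (h M hM)⟩
    have : Nontrivial M := (Subgroup.nontrivial_iff_ne_bot M).mpr hMbot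
    have hMdvd : Nat.card M ∣ 4800 := (Subgroup.card_subgroup_dvd_card M).trans hG
    have hlt : Nat.card M < n := by
      rw [← hn]
      exact lt_of_le_of_ne (Subgroup.card_le_card_group M)
        (fun h => hMtop (M.eq_top_of_card_eq h))
    rcases ih _ hlt hMdvd rfl with ⟨p, hp, N, hN, hNbot, hNp⟩ | ⟨K, hK, hKs⟩
    · exact Or.inl ⟨p, hp, hNp.exists_normal_of_normal hNbot⟩
    · have hKdvd : Nat.card K ∣ 4800 := (Subgroup.card_subgroup_dvd_card K).trans hMdvd
      rcases IsSimpleGroup.exists_isPGroup_or_of_card_dvd_4800 hKdvd with ⟨p, hp, hKp⟩ | h6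
      · exact Or.inl ⟨p, hp, hKp.exists_normal_of_normal
          ((Subgroup.nontrivial_iff_ne_bot K).mp inferInstance)⟩
      · have h30 := Sylow.thirty_dvd_card_of_card_eq_six h6
        refine Or.inr ⟨K.map M.subtype, Subgroup.normal_map_subtype_of_isSimpleGroup fun h => ?_,
          (K.equivMapOfInjective _ M.subtype_injective).symm.isSimpleGroup⟩
        have := ((mul_dvd_mul h30 h30).trans h).trans hMdvd
        omega

/-- A group of order `4800` has a nontrivial normal `p`-subgroup. -/
theorem exists_normal_isPGroup_of_card_eq_4800 [Finite G] (hG : Nat.card G = 4800) :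
    ∃ p, p.Prime ∧ ∃ N : Subgroup G, N.Normal ∧ N ≠ ⊥ ∧ IsPGroup p N := by
  have : Nontrivial G := Finite.one_lt_card_iff_nontrivial.mp (by omega)
  rcases exists_normal_isPGroup_or_isSimpleGroup hG.dvd with h | ⟨K, hK, hKs⟩
  · exact h
  rcases IsSimpleGroup.exists_isPGroup_or_of_card_dvd_4800
    (hG ▸ Subgroup.card_subgroup_dvd_card K) with ⟨p, hp, hKp⟩ | h6
  · exact ⟨p, hp, K, hK, (Subgroup.nontrivial_iff_ne_bot K).mp inferInstance, hKp⟩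
  have : Fact (Nat.Prime 5) := ⟨Nat.prime_five⟩
  let φ : G →* Equiv.Perm (Sylow 5 K) :=
    (MulAction.toPermHom (MulAut K) (Sylow 5 K)).comp MulAut.conjNormal
  have hdisj : Disjoint φ.ker K := by
    refine Subgroup.disjoint_or_le_of_isSimpleGroup.resolve_right fun hle => ?_
    have hsub : Subsingleton (Sylow 5 K) := by
      refine ⟨fun P Q => ?_⟩
      obtain ⟨k, rfl⟩ := MulAction.exists_smul_eq K P Q
      have h := Equiv.congr_fun (MonoidHom.mem_ker.mp (hle k.2)) P
      rw [MonoidHom.comp_apply, MulAut.conjNormal_val] at h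
      exact h.symm
    have := Finite.card_le_one_iff_subsingleton.mpr hsub
    omega
  have hdvd := Subgroup.card_mul_card_dvd_of_disjoint hdisj
  have h30 := Sylow.thirty_dvd_card_of_card_eq_six h6
  have hL160 : Nat.card φ.ker ∣ 160 := by
    have := (mul_dvd_mul_left (Nat.card φ.ker) h30).trans (hdvd.trans hG.dvd)
    rw [show 4800 = 160 * 30 by norm_num] at this
    exact Nat.dvd_of_mul_dvd_mul_right (by norm_num) this
  have hLnt : Nontrivial φ.ker := by
    rw [Subgroup.nontrivial_iff_ne_bot]
    intro h
    have h1 := Nat.card_le_card_of_injective φ ((MonoidHom.ker_eq_bot_iff φ).mp h)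
    rw [hG, Nat.card_perm, h6] at h1
    revert h1
    decide
  have hL4800 : Nat.card φ.ker ∣ 4800 := hL160.trans (by norm_num)
  rcases exists_normal_isPGroup_or_isSimpleGroup hL4800 with
    ⟨p, hp, N, hN, hNbot, hNp⟩ | ⟨S, hS, hSs⟩
  · exact ⟨p, hp, hNp.exists_normal_of_normal hNbot⟩
  have hSdvd := Subgroup.card_subgroup_dvd_card S
  rcases IsSimpleGroup.exists_isPGroup_or_of_card_dvd_4800 (hSdvd.trans hL4800) with
    ⟨p, hp, hSp⟩ | hS6
  · exact ⟨p, hp, hSp.exists_normal_of_normal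
      ((Subgroup.nontrivial_iff_ne_bot S).mp inferInstance)⟩
  · have := ((Sylow.thirty_dvd_card_of_card_eq_six hS6).trans hSdvd).trans hL160
    omega

end NormalSubgroups

/-- There is no finite group of order 4800 with an irreducible complex character
of degree 64. -/
theorem no_group_order_4800_degree_64 (G : Type) [Group G] [Finite G]
    (hcard : Nat.card G = 4800)
    (χ : G → ℂ) (hχ : IsIrrChar G χ) (hdeg : χ 1 = (64 : ℂ)) :
    False := by
  obtain ⟨V, hV, rfl⟩ := hχ
  have hrank : Module.finrank ℂ V = 64 := by
    rw [FDRep.char_one] at hdeg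
    exact_mod_cast hdeg
  obtain ⟨p, hp, N, hN, hNbot, hNp⟩ := exists_normal_isPGroup_of_card_eq_4800 hcard
  have : Fact p.Prime := ⟨hp⟩
  obtain ⟨Z, hZ, hZc, hZbot, hZp⟩ := hNp.exists_normal_isMulCommutative hNbot
  exact hZbot (Subgroup.eq_bot_of_isMulCommutative_of_isIrreducible hcard V hrank Z hp hZp)
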